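/- Let Ŷ = { (x,y) ∈ ℝ² : y > 0 } ∪ { (1,0), (−1,0) }, equipped with the path metric d in which d(p,q) is the infimum of the lengths (measured via the Euclidean metric of ℝ²) of paths in Ŷ joining p and q. Then no geodesic of Ŷ joins (1,0) and (−1,0); in particular Ŷ is not a geodesic space. (Counterexample following Theorem 3.1, showing that the completeness hypothesis on the branch locus cannot be dropped.) -/

import Mathlib

open Set Metric
open scoped ENNReal

noncomputable section

/-- A path in a metric space: a continuous map defined on a compact interval `[a, b]`
(with `a ≤ b`). -/
structure MPath (X : Type*) [MetricSpace X] where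
  a : ℝ
  b : ℝ
  hab : a ≤ b
  toFun : ℝ → X
  cont : ContinuousOn toFun (Set.Icc a b)

namespace MPath

variable {X : Type*} [MetricSpace X]

/-- The length of a path: the total variation of the map on `[a, b]`. -/
def length (γ : MPath X) : ℝ≥0∞ := eVariationOn γ.toFun (Set.Icc γ.a γ.b)

/-- The initial endpoint of a path. -/
def initial (γ : MPath X) : X := γ.toFun γ.a

/-- The final endpoint of a path. -/
def final (γ : MPath X) : X := γ.toFun γ.b

end MPath

/-- A geodesic in a metric space: a map on `[a, b]` with `dist (γ s) (γ t) = |s - t|`.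
(Such a map is automatically a continuous path.) -/
structure GeodesicIn (X : Type*) [MetricSpace X] where
  a : ℝ
  b : ℝ
  hab : a ≤ b
  toFun : ℝ → X
  isom : ∀ s ∈ Set.Icc a b, ∀ t ∈ Set.Icc a b, dist (toFun s) (toFun t) = |s - t|

namespace GeodesicIn

variable {X : Type*} [MetricSpace X]

/-- The initial endpoint of a geodesic. -/
def initial (γ : GeodesicIn X) : X := γ.toFun γ.a

/-- The final endpoint of a geodesic. -/
def final (γ : GeodesicIn X) : X := γ.toFun γ.b

/-- The length of a geodesic. -/
def length (γ : GeodesicIn X) : ℝ := γ.b - γ.a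

end GeodesicIn

/-- A metric space is geodesic if any two points are joined by a geodesic. -/
def IsGeodesicSpace (X : Type*) [MetricSpace X] : Prop :=
  ∀ x y : X, ∃ γ : GeodesicIn X, γ.initial = x ∧ γ.final = y

/-- Inverse hyperbolic cosine. -/
def arcoshReal (x : ℝ) : ℝ := Real.log (x + Real.sqrt (x ^ 2 - 1))

/-- The angle at a vertex of a triangle in the model space `M_κ²` whose two adjacent sides
have lengths `a`, `b` and whose opposite side has length `c`, computed by the appropriate
(euclidean, hyperbolic or spherical) law of cosines. -/
def modelAngle (κ a b c : ℝ) : ℝ :=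
  if κ = 0 then Real.arccos ((a ^ 2 + b ^ 2 - c ^ 2) / (2 * a * b))
  else if κ < 0 then
    Real.arccos
      ((Real.cosh (Real.sqrt (-κ) * a) * Real.cosh (Real.sqrt (-κ) * b) -
          Real.cosh (Real.sqrt (-κ) * c)) /
        (Real.sinh (Real.sqrt (-κ) * a) * Real.sinh (Real.sqrt (-κ) * b)))
  else
    Real.arccos
      ((Real.cos (Real.sqrt κ * c) - Real.cos (Real.sqrt κ * a) * Real.cos (Real.sqrt κ * b)) /
        (Real.sin (Real.sqrt κ * a) * Real.sin (Real.sqrt κ * b)))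

/-- The distance in the model space `M_κ²` between two points lying at distances `s` and `t`
from a common vertex, along two geodesics making an angle `θ` at that vertex, computed by the
appropriate law of cosines. -/
def modelDistFromVertex (κ s t θ : ℝ) : ℝ :=
  if κ = 0 then Real.sqrt (s ^ 2 + t ^ 2 - 2 * s * t * Real.cos θ)
  else if κ < 0 then
    (1 / Real.sqrt (-κ)) *
      arcoshReal (Real.cosh (Real.sqrt (-κ) * s) * Real.cosh (Real.sqrt (-κ) * t) -
        Real.sinh (Real.sqrt (-κ) * s) * Real.sinh (Real.sqrt (-κ) * t) * Real.cos θ)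
  else
    (1 / Real.sqrt κ) *
      Real.arccos (Real.cos (Real.sqrt κ * s) * Real.cos (Real.sqrt κ * t) +
        Real.sin (Real.sqrt κ * s) * Real.sin (Real.sqrt κ * t) * Real.cos θ)

/-- A (geodesic) triangle in a metric space: three geodesics, the final endpoint of each being
the initial endpoint of the next (indices mod 3). -/
structure TriangleIn (X : Type*) [MetricSpace X] where
  edge : Fin 3 → GeodesicIn X
  compat : ∀ i : Fin 3, (edge i).final = (edge (i + 1)).initial

namespace TriangleIn

variable {X : Type*} [MetricSpace X]

/-- The perimeter of a triangle. -/
def perimeter (T : TriangleIn X) : ℝ := ∑ i, (T.edge i).length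

/-- The distance, in a comparison triangle for `T` in the model space `M_κ²`, between the
points corresponding to the point of parameter `s` on edge `i` and the point of parameter `t`
on edge `j`.  (Any two edges of a triangle share a vertex, and the comparison distance is
computed via the model-space law of cosines at the corresponding shared vertex.) -/
def cmpDist (κ : ℝ) (T : TriangleIn X) (i j : Fin 3) (s t : ℝ) : ℝ :=
  if i = j then |s - t|
  else if j = i + 1 then
    modelDistFromVertex κ ((T.edge i).b - s) (t - (T.edge j).a)
      (modelAngle κ (T.edge i).length (T.edge j).length (T.edge (i + 2)).length)
  else
    modelDistFromVertex κ (s - (T.edge i).a) ((T.edge j).b - t)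
      (modelAngle κ (T.edge i).length (T.edge j).length (T.edge (i + 1)).length)

/-- A triangle satisfies CAT(κ) if its perimeter is `< 2π/√κ` (no condition when `κ ≤ 0`)
and each distance between points on two of its edges is at most the distance between the
corresponding points of a comparison triangle in `M_κ²`. -/
def SatisfiesCAT (κ : ℝ) (T : TriangleIn X) : Prop :=
  (0 < κ → T.perimeter < 2 * Real.pi / Real.sqrt κ) ∧
    ∀ i j : Fin 3, ∀ s ∈ Set.Icc (T.edge i).a (T.edge i).b,
      ∀ t ∈ Set.Icc (T.edge j).a (T.edge j).b,
        dist ((T.edge i).toFun s) ((T.edge j).toFun t) ≤ T.cmpDist κ i j s t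

end TriangleIn

/-- A metric space is CAT(κ) if it is geodesic and every triangle of perimeter `< 2π/√κ`
(every triangle, when `κ ≤ 0`) satisfies the CAT(κ) comparison inequality. -/
def IsCATSpace (κ : ℝ) (X : Type*) [MetricSpace X] : Prop :=
  IsGeodesicSpace X ∧
    ∀ T : TriangleIn X, (0 < κ → T.perimeter < 2 * Real.pi / Real.sqrt κ) → T.SatisfiesCAT κ

/-- `A` is a convex subset of the subspace `V`: any two points of `A` are joined by a geodesic
lying in `V`, and every geodesic lying in `V` joining two points of `A` lies in `A`. -/
def IsConvexIn {X : Type*} [MetricSpace X] (V A : Set X) : Prop :=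
  ∀ x ∈ A, ∀ y ∈ A,
    (∃ γ : GeodesicIn X, γ.initial = x ∧ γ.final = y ∧ ∀ t ∈ Set.Icc γ.a γ.b, γ.toFun t ∈ V) ∧
      ∀ γ : GeodesicIn X, γ.initial = x → γ.final = y →
        (∀ t ∈ Set.Icc γ.a γ.b, γ.toFun t ∈ V) → ∀ t ∈ Set.Icc γ.a γ.b, γ.toFun t ∈ A

/-- A convex subset of a metric space: any two of its points are joined by a geodesic of the
ambient space, and every such geodesic lies in the subset. -/
def IsConvexSubset {X : Type*} [MetricSpace X] (A : Set X) : Prop :=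
  IsConvexIn Set.univ A

/-- A metric space has curvature `≤ κ` (is locally CAT(κ)) if each point has a convex CAT(κ)
neighborhood. -/
def HasCurvatureLE (κ : ℝ) (X : Type*) [MetricSpace X] : Prop :=
  ∀ x : X, ∃ V : Set X, V ∈ nhds x ∧ IsConvexSubset V ∧ IsCATSpace κ ↥V

/-- A metric space is a length space if any two points are joined by paths of length
arbitrarily close to the distance between them. -/
def IsLengthSpace (X : Type*) [MetricSpace X] : Prop :=
  ∀ x y : X, ∀ ε : ℝ, 0 < ε →
    ∃ γ : MPath X, γ.initial = x ∧ γ.final = y ∧ γ.length < ENNReal.ofReal (dist x y + ε)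

/-- The induced path (pseudo)distance on the subset `S`: the infimum of the lengths of paths
joining `x` and `y` inside `S`. -/
def pathDistIn {X : Type*} [MetricSpace X] (S : Set X) (x y : X) : ℝ≥0∞ :=
  ⨅ (γ : MPath X) (_ : γ.initial = x) (_ : γ.final = y)
    (_ : ∀ t ∈ Set.Icc γ.a γ.b, γ.toFun t ∈ S), γ.length

/-- `π : Y → X` is a simple branched cover of `X` over `Δ ⊆ X`: `X` and `Y` are length
spaces, the restriction of `π` over the complement of `Δ` is a locally isometric covering
map onto `X − Δ`, and `π` preserves distances from points of `π⁻¹(Δ)`. -/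
structure IsSimpleBranchedCover {Y X : Type*} [MetricSpace Y] [MetricSpace X]
    (π : Y → X) (Δ : Set X) : Prop where
  base_lengthSpace : IsLengthSpace X
  total_lengthSpace : IsLengthSpace Y
  covering : IsCoveringMap fun y : {y : Y // π y ∉ Δ} => (⟨π y.1, y.2⟩ : {x : X // x ∉ Δ})
  covering_surj :
    Function.Surjective fun y : {y : Y // π y ∉ Δ} => (⟨π y.1, y.2⟩ : {x : X // x ∉ Δ})
  locally_isometric : ∀ y : Y, π y ∉ Δ → ∃ ε > 0, ∀ u v : Y, π u ∉ Δ → π v ∉ Δ →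
    dist u y < ε → dist v y < ε → dist (π u) (π v) = dist u v
  dist_eq : ∀ y z : Y, π y ∈ Δ ∨ π z ∈ Δ → dist y z = dist (π y) (π z)

/-- The restriction of a map `π : Y → X` to a subset `V ⊆ Y`, viewed as a map onto its
image. -/
def restrictToImage {Y X : Type*} (π : Y → X) (V : Set Y) : ↥V → ↥(π '' V) :=
  fun v => ⟨π v.1, ⟨v.1, v.2, rfl⟩⟩

end

/-- The space `Ŷ`: the open upper half plane together with the two points `(1,0)` and
`(-1,0)`, as a subset of the Euclidean plane. -/
def yhatSet : Set (EuclideanSpace ℝ (Fin 2)) :=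
  {p | 0 < p 1} ∪ {(WithLp.equiv 2 (Fin 2 → ℝ)).symm ![1, 0],
    (WithLp.equiv 2 (Fin 2 → ℝ)).symm ![-1, 0]}

/-- The path distance is bounded below by the ambient distance. -/
theorem edist_le_pathDistIn {X : Type*} [MetricSpace X] (S : Set X) (x y : X) :
    edist x y ≤ pathDistIn S x y := by
  refine le_iInf fun γ => le_iInf fun hx => le_iInf fun hy => le_iInf fun _ => ?_
  rw [← hx, ← hy]
  exact eVariationOn.edist_le _ (left_mem_Icc.2 γ.hab) (right_mem_Icc.2 γ.hab)

theorem dist_parabola_le {ε : ℝ} (hε : 0 ≤ ε) {s t : ℝ} (hs : s ∈ Icc (-1 : ℝ) 1)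
    (ht : t ∈ Icc (-1 : ℝ) 1) :
    dist (!₂[-s, ε * (1 - s ^ 2)] : EuclideanSpace ℝ (Fin 2)) !₂[-t, ε * (1 - t ^ 2)] ≤
      (1 + 2 * ε) * dist s t := by
  rw [EuclideanSpace.dist_eq, Real.dist_eq]
  apply Real.sqrt_le_iff.2
  refine ⟨by positivity, ?_⟩
  have h : (s + t) ^ 2 ≤ 4 := by nlinarith [hs.1, hs.2, ht.1, ht.2]
  simp only [Fin.sum_univ_two, Real.dist_eq, sq_abs, mul_pow]
  simp
  have h1 : ε ^ 2 * (s - t) ^ 2 * (s + t) ^ 2 ≤ ε ^ 2 * (s - t) ^ 2 * 4 := by gcongr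
  have h2 : 0 ≤ ε * (s - t) ^ 2 := by positivity
  nlinarith

/-- The parabolic arcs over `[-1, 1]` bound the path distance between the two boundary points of
`Ŷ` by numbers arbitrarily close to `2`. -/
theorem pathDistIn_yhatSet_le {ε : ℝ} (hε : 0 < ε) :
    pathDistIn yhatSet ((WithLp.equiv 2 (Fin 2 → ℝ)).symm ![1, 0])
      ((WithLp.equiv 2 (Fin 2 → ℝ)).symm ![-1, 0]) ≤ ENNReal.ofReal ((1 + 2 * ε) * 2) := by
  set f : ℝ → EuclideanSpace ℝ (Fin 2) := fun t => !₂[-t, ε * (1 - t ^ 2)] with hf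
  have hlip : LipschitzOnWith (1 + 2 * ε).toNNReal f (Icc (-1) 1) := by
    refine LipschitzOnWith.of_dist_le_mul fun s hs t ht => ?_
    rw [Real.coe_toNNReal _ (by positivity)]
    exact dist_parabola_le hε.le hs ht
  refine iInf_le_of_le ⟨-1, 1, by norm_num, f, hlip.continuousOn⟩ <|
    iInf_le_of_le ?_ <| iInf_le_of_le ?_ <| iInf_le_of_le ?_ ?_
  · ext i; fin_cases i <;> simp [MPath.initial, hf]
  · ext i; fin_cases i <;> simp [MPath.final, hf]
  · intro t ht
    rcases eq_or_lt_of_le ht.1 with rfl | h1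
    · right; left
      ext i; fin_cases i <;> simp [hf]
    rcases eq_or_lt_of_le ht.2 with rfl | h2
    · right; right
      ext i; fin_cases i <;> simp [hf]
    · left
      have : 0 < 1 - t ^ 2 := by nlinarith
      simpa [hf] using mul_pos hε this
  · have hid : eVariationOn (id : ℝ → ℝ) (Icc (-1) 1) ≤ ENNReal.ofReal (1 - -1) := by
      simp
    calc eVariationOn f (Icc (-1) 1)
        ≤ ENNReal.ofReal (1 + 2 * ε) * eVariationOn (id : ℝ → ℝ) (Icc (-1) 1) :=
          hlip.comp_eVariationOn_le (mapsTo_id _)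
      _ ≤ ENNReal.ofReal (1 + 2 * ε) * ENNReal.ofReal (1 - -1) := by gcongr
      _ = ENNReal.ofReal ((1 + 2 * ε) * 2) := by
          rw [← ENNReal.ofReal_mul (by positivity)]; norm_num

/-- The origin is the only point at distance at most `1` from both `(1,0)` and `(-1,0)`, and it
is not in `Ŷ`. -/
theorem notMem_yhatSet_of_dist_le_one {p : EuclideanSpace ℝ (Fin 2)}
    (h₁ : dist ((WithLp.equiv 2 (Fin 2 → ℝ)).symm ![1, 0]) p ≤ 1)
    (h₂ : dist p ((WithLp.equiv 2 (Fin 2 → ℝ)).symm ![-1, 0]) ≤ 1) : p ∉ yhatSet := by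
  rw [EuclideanSpace.dist_eq, Real.sqrt_le_one] at h₁ h₂
  simp [Real.dist_eq] at h₁ h₂
  have h0 : p 0 = 0 := by nlinarith [sq_nonneg (p 0), sq_nonneg (p 1)]
  have h1 : p 1 = 0 := by nlinarith [sq_nonneg (p 0), sq_nonneg (p 1)]
  rintro (h | h | h)
  · exact h.ne' h1
  · simp [h] at h0
  · simp [mem_singleton_iff.1 h] at h0

/-- Counterexample following Theorem 3.1: for `Ŷ` the open upper half plane together with
`(1,0)` and `(-1,0)`, equipped with the induced path metric, no geodesic of `Ŷ` joins `(1,0)`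
and `(-1,0)` (so `Ŷ` is not a geodesic space). Here a geodesic of `Ŷ` from `(1,0)` to
`(-1,0)` would be a map `γ : [a,b] → Ŷ` realizing the path distance `|s-t|` between each pair
of its points. -/
theorem stmt_19 :
    ¬ ∃ (a b : ℝ) (_ : a ≤ b) (γ : ℝ → EuclideanSpace ℝ (Fin 2)),
      γ a = (WithLp.equiv 2 (Fin 2 → ℝ)).symm ![1, 0] ∧
      γ b = (WithLp.equiv 2 (Fin 2 → ℝ)).symm ![-1, 0] ∧
      (∀ t ∈ Set.Icc a b, γ t ∈ yhatSet) ∧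
      ∀ s ∈ Set.Icc a b, ∀ t ∈ Set.Icc a b,
        pathDistIn yhatSet (γ s) (γ t) = ENNReal.ofReal |s - t| := by
  rintro ⟨a, b, hab, γ, ha, hb, hmem, hdist⟩
  have hbound : b - a ≤ 2 := by
    refine le_of_forall_pos_le_add fun ε hε => ?_
    have h := pathDistIn_yhatSet_le (ε := ε / 4) (by positivity)
    rw [← ha, ← hb, hdist a (left_mem_Icc.2 hab) b (right_mem_Icc.2 hab),
      ENNReal.ofReal_le_ofReal_iff (by positivity), abs_sub_comm, abs_of_nonneg (by linarith)] at h
    linarith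
  have hle : ∀ s ∈ Icc a b, ∀ t ∈ Icc a b, dist (γ s) (γ t) ≤ |s - t| := fun s hs t ht => by
    rw [← ENNReal.ofReal_le_ofReal_iff (abs_nonneg _), ← edist_dist, ← hdist s hs t ht]
    exact edist_le_pathDistIn _ _ _
  have hm : (a + b) / 2 ∈ Icc a b := ⟨by linarith, by linarith⟩
  have h₁ := hle a (left_mem_Icc.2 hab) _ hm
  have h₂ := hle _ hm b (right_mem_Icc.2 hab)
  rw [ha] at h₁
  rw [hb] at h₂
  refine notMem_yhatSet_of_dist_le_one (h₁.trans ?_) (h₂.trans ?_) (hmem _ hm) <;>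
    exact abs_le.2 ⟨by linarith, by linarith⟩
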